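/- Let S ≥ 1 and for each ν ∈ {0,…,S−1} let B[ν] ∈ ℂ^{M×M} be a Hermitian positive semidefinite matrix of rank K; let σ² > 0 and κ ∈ (0,1). Define R_Σ(ρ) = (1/S) Σ_{ν=0}^{S−1} [log₂ det(I_M + (ρ/σ²)·B[ν]) − log₂ det(I_M + ((1−κ)ρ/σ²)·B[ν])]. Then lim_{ρ→∞} R_Σ(ρ) = K · log₂(1/(1−κ)). -/

import Mathlib

open scoped ComplexOrder

/-- The determinant of `1 + c • A` for a Hermitian matrix `A`, in terms of its eigenvalues. -/
lemma Matrix.IsHermitian.det_one_add_smul {n : Type*} [Fintype n] [DecidableEq n]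
    {A : Matrix n n ℂ} (hA : A.IsHermitian) (c : ℝ) :
    (1 + (c : ℂ) • A).det = ((∏ i, (1 + c * hA.eigenvalues i) : ℝ) : ℂ) := by
  have h : 1 + (c : ℂ) • A = Unitary.conjStarAlgAut ℂ _ hA.eigenvectorUnitary
      (Matrix.diagonal fun i => ((1 + c * hA.eigenvalues i : ℝ) : ℂ)) := by
    have hd : (Matrix.diagonal fun i => ((1 + c * hA.eigenvalues i : ℝ) : ℂ)) =
        1 + (c : ℂ) • Matrix.diagonal (RCLike.ofReal ∘ hA.eigenvalues) := by
      rw [← Matrix.diagonal_one, ← Matrix.diagonal_smul, Matrix.diagonal_add]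
      congr 1
      ext i
      simp
    rw [hd, map_add, map_one, map_smul, ← hA.spectral_theorem]
  rw [h, Unitary.conjStarAlgAut_apply, Matrix.det_mul_comm, ← mul_assoc,
    Unitary.coe_star_mul_self, one_mul, Matrix.det_diagonal, Complex.ofReal_prod]

/-- For a positive semidefinite `A` and `c ≥ 0`, the logarithm of `det (1 + c • A)` is a sum over
the eigenvalues. -/
lemma Matrix.PosSemidef.logb_det_one_add_smul {n : Type*} [Fintype n] [DecidableEq n]
    {A : Matrix n n ℂ} (hA : A.PosSemidef) (b : ℝ) {c : ℝ} (hc : 0 ≤ c) :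
    Real.logb b (1 + (c : ℂ) • A).det.re =
      ∑ i, Real.logb b (1 + c * hA.isHermitian.eigenvalues i) := by
  rw [hA.isHermitian.det_one_add_smul, Complex.ofReal_re, Real.logb_prod]
  intro i _
  have := mul_nonneg hc (hA.eigenvalues_nonneg i)
  positivity

lemma tendsto_logb_one_add_sub_logb_one_add_mul (b : ℝ) {a : ℝ} (ha : 0 < a) :
    Filter.Tendsto (fun x : ℝ => Real.logb b (1 + x) - Real.logb b (1 + a * x))
      Filter.atTop (nhds (Real.logb b (1 / a))) := by
  have h : Filter.Tendsto (fun x : ℝ => (x⁻¹ + 1) / (x⁻¹ + a)) Filter.atTop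
      (nhds (1 / a)) := by
    have := (tendsto_inv_atTop_zero.add_const (1 : ℝ)).div
      (tendsto_inv_atTop_zero.add_const a) (by simpa using ha.ne')
    simpa only [zero_add, Pi.div_def] using this
  have hlog := (h.log (one_div_pos.2 ha).ne').div_const (Real.log b)
  refine hlog.congr' ?_
  filter_upwards [Filter.eventually_gt_atTop 0] with x hx
  rw [← Real.logb_div (by positivity) (by positivity), Real.logb]
  congr 2
  field_simp

/-- The difference of log-determinants at scales `c` and `a * c` tends to `rank A * logb b (1 / a)`
as `c → ∞`. -/
lemma Matrix.PosSemidef.tendsto_logb_det_sub_logb_det {n : Type*} [Fintype n] [DecidableEq n]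
    {A : Matrix n n ℂ} (hA : A.PosSemidef) (b : ℝ) {a : ℝ} (ha : 0 < a) :
    Filter.Tendsto
      (fun c : ℝ => Real.logb b (1 + (c : ℂ) • A).det.re -
        Real.logb b (1 + ((a * c : ℝ) : ℂ) • A).det.re)
      Filter.atTop (nhds (A.rank * Real.logb b (1 / a))) := by
  have hlim : (A.rank : ℝ) * Real.logb b (1 / a) =
      ∑ i, if hA.isHermitian.eigenvalues i ≠ 0 then Real.logb b (1 / a) else 0 := by
    rw [hA.isHermitian.rank_eq_card_non_zero_eigs, Fintype.card_subtype, Finset.sum_ite]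
    simp
  rw [hlim]
  have hsum : Filter.Tendsto
      (fun c : ℝ => ∑ i, (Real.logb b (1 + c * hA.isHermitian.eigenvalues i) -
        Real.logb b (1 + a * (c * hA.isHermitian.eigenvalues i)))) Filter.atTop
      (nhds (∑ i, if hA.isHermitian.eigenvalues i ≠ 0 then Real.logb b (1 / a) else 0)) := by
    refine tendsto_finsetSum _ fun i _ => ?_
    split_ifs with hi
    · exact (tendsto_logb_one_add_sub_logb_one_add_mul b ha).comp
        (Filter.tendsto_id.atTop_mul_const ((hA.eigenvalues_nonneg i).lt_of_ne' hi))
    · simp [not_not.1 hi]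
  refine hsum.congr' ?_
  filter_upwards [Filter.eventually_ge_atTop 0] with c hc
  rw [hA.logb_det_one_add_smul b hc, hA.logb_det_one_add_smul b (mul_nonneg ha.le hc),
    Finset.sum_sub_distrib]
  simp only [mul_assoc]

/-- Proposition 1: with `S ≥ 1` subcarriers and, on each subcarrier `ν`, a Hermitian
positive semidefinite matrix `B ν ∈ ℂ^{M×M}` of rank `K`, noise variance `σ² > 0`
and useful-signal fraction `κ ∈ (0,1)`, the average sum rate
`R_Σ(ρ) = (1/S) Σ_ν [log₂ det(I + (ρ/σ²)B ν) − log₂ det(I + ((1−κ)ρ/σ²)B ν)]`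
converges to `K·log₂(1/(1−κ))` as `ρ → ∞`. -/
theorem stmt_14 (S M K : ℕ) (hS : 1 ≤ S) (B : Fin S → Matrix (Fin M) (Fin M) ℂ)
    (hB : ∀ ν, (B ν).PosSemidef) (hrank : ∀ ν, (B ν).rank = K)
    (σ2 κ : ℝ) (hσ : 0 < σ2) (hκ : κ ∈ Set.Ioo (0:ℝ) 1) :
    Filter.Tendsto
      (fun ρ : ℝ => (1 / S : ℝ) * ∑ ν : Fin S,
        (Real.logb 2 ((1 + ((ρ / σ2 : ℝ) : ℂ) • B ν).det.re) -
          Real.logb 2 ((1 + (((1 - κ) * ρ / σ2 : ℝ) : ℂ) • B ν).det.re)))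
      Filter.atTop (nhds (K * Real.logb 2 (1 / (1 - κ)))) := by
  have hS' : (S : ℝ) ≠ 0 := by exact_mod_cast (Nat.one_le_iff_ne_zero.1 hS)
  have hscale : Filter.Tendsto (fun ρ : ℝ => ρ / σ2) Filter.atTop Filter.atTop :=
    Filter.tendsto_id.atTop_div_const hσ
  have hsum := (tendsto_finsetSum Finset.univ fun ν (_ : ν ∈ Finset.univ) =>
    ((hB ν).tendsto_logb_det_sub_logb_det 2 (sub_pos.2 hκ.2)).comp hscale).const_mul (1 / S : ℝ)
  have hlim : (1 / S : ℝ) * ∑ ν : Fin S, ((B ν).rank : ℝ) * Real.logb 2 (1 / (1 - κ)) =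
      K * Real.logb 2 (1 / (1 - κ)) := by
    simp only [hrank, Finset.sum_const, Finset.card_univ, Fintype.card_fin, nsmul_eq_mul]
    field_simp
  rw [hlim] at hsum
  simpa only [Function.comp_def, mul_div_assoc] using hsum
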